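/- arXiv:math/0410075 — 4 statements merged into one kernel-verified Lean document; each statement's English description precedes it below -/
import Mathlib

section
/- Let A be a simplicial Lie algebra over ℚ, let p, q ≥ 1, let x ∈ A_p satisfy d_i x = 0 for all 1 ≤ i ≤ p−1, and let y ∈ A_q satisfy d_j y = 0 for all 1 ≤ j ≤ q−1. Then the shuffle bracket ⟦x,y⟧ ∈ A_{p+q} satisfies d_k(⟦x,y⟧) = 0 for all 1 ≤ k ≤ p+q−1. -/
/-- A simplicial Lie algebra over `ℚ`: a family of `ℚ`-Lie algebras `A n` with
face maps `d n i : A n → A (n-1)` (meaningful for `0 ≤ i ≤ n`, `n ≥ 1`) and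
degeneracy maps `s n j : A n → A (n+1)` (meaningful for `0 ≤ j ≤ n`), which are
Lie algebra homomorphisms satisfying the simplicial identities in the valid
ranges of indices. -/
structure SimplicialLieQ where
  A : ℕ → Type
  [lieRing : ∀ n, LieRing (A n)]
  [lieAlgebra : ∀ n, LieAlgebra ℚ (A n)]
  d : ∀ n : ℕ, ℕ → A n →ₗ⁅ℚ⁆ A (n - 1)
  s : ∀ n : ℕ, ℕ → A n →ₗ⁅ℚ⁆ A (n + 1)
  dd : ∀ (n i j : ℕ), i < j → j ≤ n + 2 → ∀ x : A (n + 2),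
    d (n + 1) i (d (n + 2) j x) = d (n + 1) (j - 1) (d (n + 2) i x)
  ss : ∀ (n i j : ℕ), i ≤ j → j ≤ n → ∀ x : A n,
    s (n + 1) i (s n j x) = s (n + 1) (j + 1) (s n i x)
  ds_lt : ∀ (n i j : ℕ), i < j → j ≤ n + 1 → ∀ x : A (n + 1),
    d (n + 2) i (s (n + 1) j x) = s n (j - 1) (d (n + 1) i x)
  ds_eq : ∀ (n j : ℕ), j ≤ n → ∀ x : A n, d (n + 1) j (s n j x) = x
  ds_eq' : ∀ (n j : ℕ), j ≤ n → ∀ x : A n, d (n + 1) (j + 1) (s n j x) = x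
  ds_gt : ∀ (n i j : ℕ), j + 1 < i → i ≤ n + 2 → ∀ x : A (n + 1),
    d (n + 2) i (s (n + 1) j x) = s n j (d (n + 1) (i - 1) x)

attribute [instance] SimplicialLieQ.lieRing SimplicialLieQ.lieAlgebra

namespace SimplicialLieQ

/-- Iterated degeneracies: `iterS n k f x = s (f (k-1)) (⋯ (s (f 1) (s (f 0) x)))`,
i.e. `s (f 0)` is applied first (innermost). -/
def iterS (X : SimplicialLieQ) (n : ℕ) : (k : ℕ) → (Fin k → ℕ) → X.A n → X.A (n + k)
  | 0, _, x => x
  | k + 1, f, x => X.s (n + k) (f (Fin.last k)) (X.iterS n k (fun i => f i.castSucc) x)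

end SimplicialLieQ

/-- For a subset `σ = {σ_1 < … < σ_p}` of `{0,…,m-1}` (with `p = σ.card`), the
exponent `ε(σ) = p + ∑_{i=1}^p (σ_i - i)`, computed in `ℤ`; here
`∑_{i=1}^p σ_i = ∑_{a ∈ σ} a` and `∑_{i=1}^p i = ∑_{i ∈ range p} (i+1)`. -/
def shuffleSign {m : ℕ} (σ : Finset (Fin m)) : ℤ :=
  (σ.card : ℤ) + ((∑ a ∈ σ, ((a : ℕ) : ℤ)) - ∑ i ∈ Finset.range σ.card, ((i : ℤ) + 1))

lemma card_compl_shuffle {p q : ℕ} (σ : Finset (Fin (p + q))) (h : σ.card = p) :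
    σᶜ.card = q := by
  have hc := Finset.card_compl σ
  rw [h, Fintype.card_fin] at hc
  omega

namespace SimplicialLieQ

/-- The summand of the shuffle bracket corresponding to a `(p,q)`-shuffle `(σ, τ)`
(with `τ = σᶜ`): `[s_{τ_q} ⋯ s_{τ_1} x, s_{σ_p} ⋯ s_{σ_1} y]`. -/
noncomputable def shuffleTerm (X : SimplicialLieQ) {p q : ℕ} (x : X.A p) (y : X.A q)
    (σ : Finset (Fin (p + q))) (h : σ.card = p) : X.A (p + q) :=
  ⁅X.iterS p q (fun j => ((σᶜ.orderEmbOfFin (card_compl_shuffle σ h)) j : ℕ)) x,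
   cast (congrArg X.A (Nat.add_comm q p))
     (X.iterS q p (fun i => ((σ.orderEmbOfFin h) i : ℕ)) y)⁆

/-- The shuffle bracket
`⟦x,y⟧ = ∑_{(σ,τ) ∈ S_{p,q}} (-1)^{ε(σ)} [s_{τ_q} ⋯ s_{τ_1} x, s_{σ_p} ⋯ s_{σ_1} y]`. -/
noncomputable def shuffleBracket (X : SimplicialLieQ) {p q : ℕ}
    (x : X.A p) (y : X.A q) : X.A (p + q) :=
  ∑ σ : Finset (Fin (p + q)),
    if h : σ.card = p then ((-1 : ℚ) ^ shuffleSign σ) • X.shuffleTerm x y σ h else 0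

end SimplicialLieQ

namespace SimplicialLieQ

lemma d_s_eq_zero_of_lt (X : SimplicialLieQ) {n i j : ℕ} (hn : 1 ≤ n) (hij : i < j) (hj : j ≤ n)
    {z : X.A n} (hz : X.d n i z = 0) : X.d (n + 1) i (X.s n j z) = 0 := by
  obtain ⟨m, rfl⟩ : ∃ m, n = m + 1 := ⟨n - 1, by omega⟩
  have h := X.ds_lt m i j hij hj z
  rw [hz] at h
  exact h.trans (map_zero _)

lemma d_s_eq_zero_of_gt (X : SimplicialLieQ) {n i j : ℕ} (hn : 1 ≤ n) (hij : j + 1 < i)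
    (hi : i ≤ n + 1) {z : X.A n} (hz : X.d n (i - 1) z = 0) : X.d (n + 1) i (X.s n j z) = 0 := by
  obtain ⟨m, rfl⟩ : ∃ m, n = m + 1 := ⟨n - 1, by omega⟩
  have h := X.ds_gt m i j hij hi z
  rw [hz] at h
  exact h.trans (map_zero _)

lemma d_s_congr_of_lt (X : SimplicialLieQ) {n i j : ℕ} (hn : 1 ≤ n) (hij : i < j) (hj : j ≤ n)
    {z z' : X.A n} (hz : X.d n i z = X.d n i z') :
    X.d (n + 1) i (X.s n j z) = X.d (n + 1) i (X.s n j z') := by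
  obtain ⟨m, rfl⟩ : ∃ m, n = m + 1 := ⟨n - 1, by omega⟩
  have h := X.ds_lt m i j hij hj z
  rw [hz] at h
  exact h.trans (X.ds_lt m i j hij hj z').symm

lemma d_cast_eq_zero (X : SimplicialLieQ) {m n : ℕ} (h : m = n) (k : ℕ) {z : X.A m}
    (hz : X.d m k z = 0) : X.d n k (cast (congrArg X.A h) z) = 0 := by
  subst h
  exact hz

lemma d_cast_congr (X : SimplicialLieQ) {m n : ℕ} (h : m = n) (k : ℕ) {z z' : X.A m}
    (hz : X.d m k z = X.d m k z') :
    X.d n k (cast (congrArg X.A h) z) = X.d n k (cast (congrArg X.A h) z') := by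
  subst h
  exact hz

/-- A face `d_k` whose index satisfies `k, k - 1 ∉ {f_i}` commutes past the iterated
degeneracy, its index dropping by one for each `f_i < k`. -/
lemma d_iterS_eq_zero (X : SimplicialLieQ) {n : ℕ} (hn : 1 ≤ n) (x : X.A n) :
    ∀ (q : ℕ) (f : Fin q → ℕ) (k : ℕ), StrictMono f → (∀ i, f i < n + q) → k ≤ n + q →
      (∀ i, f i ≠ k) → (∀ i, f i + 1 ≠ k) →
      X.d n (k - (Finset.univ.filter fun i => f i < k).card) x = 0 →
      X.d (n + q) k (X.iterS n q f x) = 0 := by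
  intro q
  induction q with
  | zero =>
    intro f k _ _ _ _ _ h
    simpa [iterS] using h
  | succ q ih =>
    intro f k hf hb hk h1 h2 h
    have hlt : ∀ i : Fin q, f i.castSucc < f (Fin.last q) := fun i => hf (Fin.castSucc_lt_last i)
    have hlast := hb (Fin.last q)
    have hf' : StrictMono fun i : Fin q => f i.castSucc := fun i j hij =>
      hf (Fin.castSucc_lt_castSucc_iff.2 hij)
    have hb' : ∀ i : Fin q, f i.castSucc < n + q := fun i => by have := hlt i; omega
    have h1l := h1 (Fin.last q)
    have h2l := h2 (Fin.last q)
    rw [Finset.card_filter, Fin.sum_univ_castSucc, ← Finset.card_filter] at h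
    rcases lt_or_ge k (f (Fin.last q)) with hlk | hlk
    · refine X.d_s_eq_zero_of_lt (n := n + q) (by omega) hlk (by omega) ?_
      refine ih _ k hf' hb' (by omega) (fun i => h1 _) (fun i => h2 _) ?_
      rwa [if_neg (by omega), Nat.add_zero] at h
    · refine X.d_s_eq_zero_of_gt (n := n + q) (by omega) (by omega) (by omega) ?_
      refine ih _ (k - 1) hf' hb' (by omega) (fun i => by have := hlt i; omega)
        (fun i => by have := hlt i; omega) ?_
      rw [if_pos (by omega)] at h
      rw [Finset.filter_true_of_mem fun i _ => by have := hlt i; omega]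
      rw [Finset.filter_true_of_mem fun i _ => by have := hlt i; omega] at h
      rwa [Nat.sub_sub, Nat.add_comm 1]

/-- The face `d_{k+1}` does not distinguish two iterated degeneracies that differ only in
that one uses `s_{k+1}` where the other uses `s_k`. -/
lemma d_iterS_congr (X : SimplicialLieQ) {n : ℕ} (hn : 1 ≤ n) (x : X.A n) (k : ℕ) :
    ∀ (q : ℕ) (f g : Fin q → ℕ), StrictMono f → StrictMono g → (∀ i, f i < n + q) →
      (∃ i, f i = k + 1) → (∀ i, f i = k + 1 → g i = k) → (∀ i, f i ≠ k + 1 → g i = f i) →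
      X.d (n + q) (k + 1) (X.iterS n q f x) = X.d (n + q) (k + 1) (X.iterS n q g x) := by
  intro q
  induction q with
  | zero => exact fun f g _ _ _ ⟨i, _⟩ => i.elim0
  | succ q ih =>
    intro f g hf hg hb hex he hne
    have hlt : ∀ i : Fin q, f i.castSucc < f (Fin.last q) := fun i => hf (Fin.castSucc_lt_last i)
    have hlast := hb (Fin.last q)
    by_cases hl : f (Fin.last q) = k + 1
    · have hgf : (fun i : Fin q => g i.castSucc) = fun i : Fin q => f i.castSucc :=
        funext fun i => hne _ (by have := hlt i; omega)
      simp only [iterS, hgf, hl, he _ hl]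
      exact (X.ds_eq (n + q) (k + 1) (by omega) _).trans (X.ds_eq' (n + q) k (by omega) _).symm
    · obtain ⟨i, hi⟩ := hex
      obtain ⟨j, rfl⟩ : ∃ j : Fin q, j.castSucc = i :=
        Fin.exists_castSucc_eq.2 fun h => hl (h ▸ hi)
      have hj := hlt j
      simp only [iterS, hne _ hl]
      refine X.d_s_congr_of_lt (n := n + q) (by omega) (by omega) (by omega) ?_
      exact ih _ _ (fun i j hij => hf (Fin.castSucc_lt_castSucc_iff.2 hij))
        (fun i j hij => hg (Fin.castSucc_lt_castSucc_iff.2 hij))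
        (fun i => by have := hlt i; omega) ⟨j, hi⟩ (fun i => he _) (fun i => hne _)

end SimplicialLieQ

section AdjacentSwap

variable {m : ℕ} {a b : Fin m}

lemma swap_strictMono_of_not_mem_both {s : Finset (Fin m)} {r : ℕ} (hab : (a : ℕ) + 1 = b)
    (h : ¬ (a ∈ s ∧ b ∈ s)) (hs : s.card = r) :
    StrictMono fun i => Equiv.swap a b (s.orderEmbOfFin hs i) := by
  intro i j hij
  have hlt : s.orderEmbOfFin hs i < s.orderEmbOfFin hs j := (s.orderEmbOfFin hs).strictMono hij
  have hi := s.orderEmbOfFin_mem hs i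
  have hj := s.orderEmbOfFin_mem hs j
  simp only
  generalize s.orderEmbOfFin hs i = u at *
  generalize s.orderEmbOfFin hs j = v at *
  have hnot : ¬ (u = a ∧ v = b) := by
    rintro ⟨rfl, rfl⟩
    exact h ⟨hi, hj⟩
  simp only [Equiv.swap_apply_def]
  simp only [Fin.lt_def, Fin.ext_iff] at *
  split_ifs <;> omega

lemma orderEmbOfFin_eq_swap {s t : Finset (Fin m)} {r : ℕ} (hab : (a : ℕ) + 1 = b)
    (h : ¬ (a ∈ s ∧ b ∈ s)) (hs : s.card = r) (ht : t.card = r)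
    (hst : ∀ u ∈ s, Equiv.swap a b u ∈ t) (i : Fin r) :
    t.orderEmbOfFin ht i = Equiv.swap a b (s.orderEmbOfFin hs i) :=
  (congrFun (Finset.orderEmbOfFin_unique ht
    (fun i => hst _ (s.orderEmbOfFin_mem hs i)) (swap_strictMono_of_not_mem_both hab h hs)) i).symm

lemma shuffleSign_map_swap {s : Finset (Fin m)} (hab : (a : ℕ) + 1 = b) (ha : a ∈ s)
    (hb : b ∉ s) :
    shuffleSign (s.map (Equiv.swap a b).toEmbedding) = shuffleSign s + 1 := by
  have hsum : ∑ u ∈ s, ((Equiv.swap a b u : ℕ) : ℤ)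
      = ∑ u ∈ s, (((u : ℕ) : ℤ) + if u = a then 1 else 0) := by
    refine Finset.sum_congr rfl fun u hu => ?_
    have hub : u ≠ b := fun h => hb (h ▸ hu)
    rw [Equiv.swap_apply_def, if_neg hub]
    split_ifs with hua
    · subst hua
      exact_mod_cast hab.symm
    · simp
  rw [Finset.sum_add_distrib, Finset.sum_ite_eq' s a, if_pos ha] at hsum
  simp only [shuffleSign, Finset.card_map, Finset.sum_map, Equiv.coe_toEmbedding, hsum]
  ring

lemma compl_map_equiv (e : Equiv.Perm (Fin m)) (s : Finset (Fin m)) :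
    (s.map e.toEmbedding)ᶜ = sᶜ.map e.toEmbedding := by
  ext u
  simp [Finset.mem_map_equiv]

end AdjacentSwap

lemma card_filter_orderEmbOfFin {m r : ℕ} (s : Finset (Fin m)) (hs : s.card = r)
    (k : ℕ) : (Finset.univ.filter fun i => (s.orderEmbOfFin hs i : ℕ) < k).card
      = (s.filter fun u : Fin m => (u : ℕ) < k).card := by
  conv_rhs => rw [← Finset.map_orderEmbOfFin_univ s hs, Finset.filter_map, Finset.card_map]
  rfl

lemma card_filter_lt_add_compl {m : ℕ} (s : Finset (Fin m)) {k : ℕ} (hk : k ≤ m) :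
    (s.filter fun u : Fin m => (u : ℕ) < k).card + (sᶜ.filter fun u : Fin m => (u : ℕ) < k).card = k := by
  rw [← Finset.card_union_of_disjoint
    (Finset.disjoint_filter_filter disjoint_compl_right), ← Finset.filter_union,
    Finset.union_compl, Fin.card_filter_val_lt, min_eq_right hk]

namespace SimplicialLieQ

/-- Iterated degeneracies indexed by the increasing enumeration of `t`, on an element killed by
the inner faces, are killed by `d_b` as soon as `b` and its predecessor `a` both avoid `t`. -/
lemma d_iterS_orderEmbOfFin_eq_zero (X : SimplicialLieQ) {m n r : ℕ} (hn : 1 ≤ n)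
    (hm : m = n + r) {x : X.A n} (hx : ∀ i : ℕ, 1 ≤ i → i ≤ n - 1 → X.d n i x = 0)
    {t : Finset (Fin m)} (ht : t.card = r) {a b : Fin m} (hab : (a : ℕ) + 1 = b)
    (ha : a ∉ t) (hb : b ∉ t) :
    X.d (n + r) b (X.iterS n r (fun i => (t.orderEmbOfFin ht i : ℕ)) x) = 0 := by
  have hsub : tᶜ.card = n := by
    rw [Finset.card_compl, Fintype.card_fin]
    omega
  have hmem := fun i => t.orderEmbOfFin_mem ht i
  refine X.d_iterS_eq_zero hn x r _ b (fun i j hij => (t.orderEmbOfFin ht).strictMono hij)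
    (fun i => hm ▸ (t.orderEmbOfFin ht i).isLt) (by have := b.isLt; omega)
    (fun i hi => hb (Fin.ext hi ▸ hmem i))
    (fun i hi => ha ((Fin.ext (by omega) : t.orderEmbOfFin ht i = a) ▸ hmem i)) ?_
  rw [card_filter_orderEmbOfFin]
  have hadd := card_filter_lt_add_compl t (k := b) b.isLt.le
  have hpos : 0 < (tᶜ.filter fun u : Fin m => (u : ℕ) < b).card :=
    Finset.card_pos.2 ⟨a, by simp only [Finset.mem_filter, Finset.mem_compl]; exact ⟨ha, by omega⟩⟩
  have hlt : (tᶜ.filter fun u : Fin m => (u : ℕ) < b).card < tᶜ.card :=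
    Finset.card_lt_card (Finset.filter_ssubset.2 ⟨b, by simpa using hb, by simp⟩)
  exact hx _ (by omega) (by omega)

/-- Swapping the adjacent indices `a` and `b = a + 1` does not change the `b`-th face of an
iterated degeneracy when exactly one of them, namely `b`, is used. -/
lemma d_iterS_orderEmbOfFin_swap (X : SimplicialLieQ) {m n r : ℕ} (hn : 1 ≤ n)
    (hm : m = n + r) (x : X.A n) {s t : Finset (Fin m)} (hs : s.card = r) (ht : t.card = r)
    {a b : Fin m} (hab : (a : ℕ) + 1 = b) (ha : a ∉ s) (hb : b ∈ s)
    (hst : ∀ u ∈ s, Equiv.swap a b u ∈ t) :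
    X.d (n + r) b (X.iterS n r (fun i => (s.orderEmbOfFin hs i : ℕ)) x)
      = X.d (n + r) b (X.iterS n r (fun i => (t.orderEmbOfFin ht i : ℕ)) x) := by
  have hmem := fun i => s.orderEmbOfFin_mem hs i
  have hsw := orderEmbOfFin_eq_swap hab (fun h => ha h.1) hs ht hst
  rw [← hab]
  refine X.d_iterS_congr hn x a r _ _ (fun i j hij => (s.orderEmbOfFin hs).strictMono hij)
    (fun i j hij => (t.orderEmbOfFin ht).strictMono hij)
    (fun i => hm ▸ (s.orderEmbOfFin hs i).isLt) ?_ (fun i hi => ?_) (fun i hi => ?_)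
  · obtain ⟨i, hi⟩ : b ∈ Set.range (s.orderEmbOfFin hs) := by
      rw [Finset.range_orderEmbOfFin]
      exact hb
    exact ⟨i, by rw [hi, hab]⟩
  · have hib : s.orderEmbOfFin hs i = b := Fin.ext (hi.trans hab)
    rw [hsw, hib, Equiv.swap_apply_right]
  · rw [hsw, Equiv.swap_apply_of_ne_of_ne]
    · exact fun h => ha (h ▸ hmem i)
    · exact fun h => hi (by rw [h, hab])

variable (X : SimplicialLieQ) {p q : ℕ} {x : X.A p} {y : X.A q}
  {σ : Finset (Fin (p + q))} {a b : Fin (p + q)}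

lemma d_shuffleTerm_eq_zero_of_mem (hp : 1 ≤ p)
    (hx : ∀ i : ℕ, 1 ≤ i → i ≤ p - 1 → X.d p i x = 0) (h : σ.card = p)
    (hab : (a : ℕ) + 1 = b) (ha : a ∈ σ) (hb : b ∈ σ) :
    X.d (p + q) b (X.shuffleTerm x y σ h) = 0 := by
  rw [shuffleTerm, LieHom.map_lie, X.d_iterS_orderEmbOfFin_eq_zero hp rfl hx _ hab
    (by simpa using ha) (by simpa using hb), zero_lie]

lemma d_shuffleTerm_eq_zero_of_notMem (hq : 1 ≤ q)
    (hy : ∀ j : ℕ, 1 ≤ j → j ≤ q - 1 → X.d q j y = 0) (h : σ.card = p)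
    (hab : (a : ℕ) + 1 = b) (ha : a ∉ σ) (hb : b ∉ σ) :
    X.d (p + q) b (X.shuffleTerm x y σ h) = 0 := by
  rw [shuffleTerm, LieHom.map_lie, X.d_cast_eq_zero (Nat.add_comm q p) b
    (X.d_iterS_orderEmbOfFin_eq_zero hq (Nat.add_comm p q) hy h hab ha hb), lie_zero]

lemma d_shuffleTerm_map_swap (hp : 1 ≤ p) (hq : 1 ≤ q) (h : σ.card = p)
    (h' : (σ.map (Equiv.swap a b).toEmbedding).card = p)
    (hab : (a : ℕ) + 1 = b) (ha : a ∈ σ) (hb : b ∉ σ) :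
    X.d (p + q) b (X.shuffleTerm x y (σ.map (Equiv.swap a b).toEmbedding) h')
      = X.d (p + q) b (X.shuffleTerm x y σ h) := by
  rw [shuffleTerm, shuffleTerm, LieHom.map_lie, LieHom.map_lie]
  congr 1
  · refine (X.d_iterS_orderEmbOfFin_swap hp rfl x _ _ hab (by simpa using ha)
      (by simpa using hb) fun u hu => ?_).symm
    rw [compl_map_equiv]
    exact Finset.mem_map_of_mem _ hu
  · refine X.d_cast_congr (Nat.add_comm q p) b
      (X.d_iterS_orderEmbOfFin_swap hq (Nat.add_comm p q) y _ _ hab ?_ ?_ fun u hu => ?_)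
    · simpa [Finset.mem_map_equiv] using hb
    · simpa [Finset.mem_map_equiv] using ha
    · simpa [Finset.mem_map_equiv] using hu

end SimplicialLieQ

/-- Let `A` be a simplicial Lie algebra over `ℚ`, let `p, q ≥ 1`,
let `x ∈ A_p` satisfy `d_i x = 0` for all `1 ≤ i ≤ p-1`, and let `y ∈ A_q` satisfy
`d_j y = 0` for all `1 ≤ j ≤ q-1`.  Then the shuffle bracket `⟦x,y⟧ ∈ A_{p+q}`
satisfies `d_k ⟦x,y⟧ = 0` for all `1 ≤ k ≤ p+q-1`. -/
theorem shuffleBracket_face_vanish (X : SimplicialLieQ) (p q : ℕ) (hp : 1 ≤ p) (hq : 1 ≤ q)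
    (x : X.A p) (y : X.A q)
    (hx : ∀ i : ℕ, 1 ≤ i → i ≤ p - 1 → X.d p i x = 0)
    (hy : ∀ j : ℕ, 1 ≤ j → j ≤ q - 1 → X.d q j y = 0) :
    ∀ k : ℕ, 1 ≤ k → k ≤ p + q - 1 → X.d (p + q) k (X.shuffleBracket x y) = 0 := by
  intro k hk hkpq
  obtain ⟨a, b, hab, rfl⟩ : ∃ a b : Fin (p + q), (a : ℕ) + 1 = b ∧ (b : ℕ) = k :=
    ⟨⟨k - 1, by omega⟩, ⟨k, by omega⟩, by simp only; omega, rfl⟩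
  have hswap : ∀ σ : Finset (Fin (p + q)),
      (σ.map (Equiv.swap a b).toEmbedding).map (Equiv.swap a b).toEmbedding = σ := by
    intro σ
    ext u
    simp [Finset.mem_map_equiv]
  have hcancel : ∀ (σ : Finset (Fin (p + q))) (h : σ.card = p)
      (h' : (σ.map (Equiv.swap a b).toEmbedding).card = p), a ∈ σ → b ∉ σ →
      X.d (p + q) b (((-1 : ℚ) ^ shuffleSign σ) • X.shuffleTerm x y σ h)
        + X.d (p + q) b (((-1 : ℚ) ^ shuffleSign (σ.map (Equiv.swap a b).toEmbedding)) •
          X.shuffleTerm x y (σ.map (Equiv.swap a b).toEmbedding) h') = 0 := by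
    intro σ h h' ha hb
    rw [map_smul, map_smul, X.d_shuffleTerm_map_swap hp hq h h' hab ha hb,
      shuffleSign_map_swap hab ha hb, zpow_add_one₀ (by norm_num), mul_neg_one, neg_smul,
      add_neg_cancel]
  rw [SimplicialLieQ.shuffleBracket, map_sum]
  refine Finset.sum_involution (fun σ _ => σ.map (Equiv.swap a b).toEmbedding)
    (fun σ _ => ?_) (fun σ _ hσ hfix => hσ ?_) (fun _ _ => Finset.mem_univ _)
    (fun σ _ => hswap σ)
  · by_cases h : σ.card = p
    · have h' : (σ.map (Equiv.swap a b).toEmbedding).card = p := by rwa [Finset.card_map]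
      rw [dif_pos h, dif_pos h']
      by_cases ha : a ∈ σ <;> by_cases hb : b ∈ σ
      · rw [map_smul, map_smul, X.d_shuffleTerm_eq_zero_of_mem hp hx h hab ha hb,
          X.d_shuffleTerm_eq_zero_of_mem hp hx h' hab (by simpa [Finset.mem_map_equiv] using hb)
            (by simpa [Finset.mem_map_equiv] using ha), smul_zero, smul_zero, add_zero]
      · exact hcancel σ h h' ha hb
      · have hc := hcancel _ h' (by rwa [hswap]) (by simpa [Finset.mem_map_equiv] using hb)
          (by simpa [Finset.mem_map_equiv] using ha)
        simp only [hswap] at hc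
        exact (add_comm _ _).trans hc
      · rw [map_smul, map_smul, X.d_shuffleTerm_eq_zero_of_notMem hq hy h hab ha hb,
          X.d_shuffleTerm_eq_zero_of_notMem hq hy h' hab
            (by simpa [Finset.mem_map_equiv] using hb)
            (by simpa [Finset.mem_map_equiv] using ha), smul_zero, smul_zero, add_zero]
    · rw [dif_neg h, dif_neg (by rwa [Finset.card_map]), map_zero, add_zero]
  · have hiff : a ∈ σ ↔ b ∈ σ := by
      conv_lhs => rw [← hfix]
      simp [Finset.mem_map_equiv]
    split_ifs with h
    · by_cases ha : a ∈ σ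
      · rw [map_smul, X.d_shuffleTerm_eq_zero_of_mem hp hx h hab ha (hiff.1 ha), smul_zero]
      · rw [map_smul, X.d_shuffleTerm_eq_zero_of_notMem hq hy h hab ha
          fun hb => ha (hiff.2 hb), smul_zero]
    · exact map_zero _
end

section
/- Let A be a simplicial Lie algebra over ℚ and let x ∈ A_p, y ∈ A_q (p, q ≥ 0). Then the shuffle bracket satisfies the graded antisymmetry law ⟦y,x⟧ = (−1)^{pq+1} ⟦x,y⟧ in A_{p+q}. -/
lemma shuffleSign_eq {m : ℕ} (σ : Finset (Fin m)) :
    shuffleSign σ = ∑ a ∈ σ, ((a : ℕ) : ℤ) - ∑ i ∈ Finset.range σ.card, (i : ℤ) := by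
  simp only [shuffleSign, Finset.sum_add_distrib, Finset.sum_const, Finset.card_range, nsmul_eq_mul,
    mul_one]
  ring

lemma sum_range_add_eq_add_mul (p q : ℕ) :
    ∑ i ∈ Finset.range (p + q), (i : ℤ) =
      ∑ i ∈ Finset.range p, (i : ℤ) + ∑ i ∈ Finset.range q, (i : ℤ) + p * q := by
  rw [Finset.sum_range_add]
  simp only [Nat.cast_add, Finset.sum_add_distrib, Finset.sum_const, Finset.card_range,
    nsmul_eq_mul]
  ring

lemma shuffleSign_add_compl {p q : ℕ} (σ : Finset (Fin (p + q))) (h : σ.card = p) :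
    shuffleSign σ + shuffleSign σᶜ = p * q := by
  have hsum : ∑ a ∈ σ, ((a : ℕ) : ℤ) + ∑ a ∈ σᶜ, ((a : ℕ) : ℤ) =
      ∑ i ∈ Finset.range (p + q), (i : ℤ) := by
    rw [Finset.sum_add_sum_compl, Fin.sum_univ_eq_sum_range (fun i => (i : ℤ))]
  rw [shuffleSign_eq, shuffleSign_eq, h, card_compl_shuffle σ h]
  linear_combination hsum + sum_range_add_eq_add_mul p q

lemma shuffleSign_map_finCongr {m n : ℕ} (e : m = n) (σ : Finset (Fin m)) :
    shuffleSign (σ.map (finCongr e).toEmbedding) = shuffleSign σ := by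
  simp [shuffleSign]

lemma neg_one_zpow_shuffleSign_compl {p q : ℕ} (σ : Finset (Fin (p + q))) (h : σ.card = p) :
    (-1 : ℚ) ^ shuffleSign σᶜ = (-1) ^ (p * q) * (-1) ^ shuffleSign σ := by
  have hc : shuffleSign σᶜ = ((p * q : ℕ) : ℤ) + -shuffleSign σ := by
    push_cast
    linear_combination shuffleSign_add_compl σ h
  rw [hc, zpow_add₀ (by norm_num), zpow_natCast, zpow_neg, ← inv_zpow, inv_neg_one]

lemma orderEmbOfFin_map_finCongr {m n k : ℕ} (e : m = n) (s : Finset (Fin m)) (t : Finset (Fin n))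
    (hst : s.map (finCongr e).toEmbedding = t) (hs : s.card = k) (ht : t.card = k) (i : Fin k) :
    (s.orderEmbOfFin hs i : ℕ) = t.orderEmbOfFin ht i := by
  subst e hst
  have : s.map (finCongr (rfl : m = m)).toEmbedding = s := by ext; simp
  simp only [this]

namespace SimplicialLieQ

lemma cast_lie (X : SimplicialLieQ) {m n : ℕ} (e : m = n) (a b : X.A m) :
    cast (congrArg X.A e) ⁅a, b⁆ = ⁅cast (congrArg X.A e) a, cast (congrArg X.A e) b⁆ := by
  subst e; rfl

lemma cast_smul (X : SimplicialLieQ) {m n : ℕ} (e : m = n) (c : ℚ) (a : X.A m) :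
    cast (congrArg X.A e) (c • a) = c • cast (congrArg X.A e) a := by
  subst e; rfl

lemma cast_zero (X : SimplicialLieQ) {m n : ℕ} (e : m = n) :
    cast (congrArg X.A e) (0 : X.A m) = 0 := by
  subst e; rfl

lemma cast_sum (X : SimplicialLieQ) {m n : ℕ} (e : m = n) {ι : Type*} (s : Finset ι)
    (f : ι → X.A m) :
    cast (congrArg X.A e) (∑ i ∈ s, f i) = ∑ i ∈ s, cast (congrArg X.A e) (f i) := by
  subst e; rfl

lemma cast_shuffleTerm (X : SimplicialLieQ) {p q : ℕ} (x : X.A p) (y : X.A q)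
    (σ : Finset (Fin (p + q))) (h : σ.card = p) (τ : Finset (Fin (q + p))) (hτ : τ.card = q)
    (hστ : σᶜ.map (finCongr (Nat.add_comm p q)).toEmbedding = τ) :
    cast (congrArg X.A (Nat.add_comm q p)) (X.shuffleTerm y x τ hτ) = -X.shuffleTerm x y σ h := by
  have hτσ : σ.map (finCongr (Nat.add_comm p q)).toEmbedding = τᶜ := by
    subst hστ
    ext a
    simp [Finset.mem_map_equiv]
  simp only [shuffleTerm, X.cast_lie (Nat.add_comm q p), cast_cast, cast_eq,
    orderEmbOfFin_map_finCongr _ _ _ hτσ h (card_compl_shuffle τ hτ),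
    orderEmbOfFin_map_finCongr _ _ _ hστ (card_compl_shuffle σ h) hτ]
  rw [lie_skew]

end SimplicialLieQ

/-- For a simplicial Lie algebra `A` over `ℚ` and `x ∈ A_p`,
`y ∈ A_q` (`p, q ≥ 0`), the shuffle bracket satisfies graded antisymmetry:
`⟦y,x⟧ = (-1)^{pq+1} ⟦x,y⟧` in `A_{p+q}`. -/
theorem shuffleBracket_antisymm (X : SimplicialLieQ) (p q : ℕ)
    (x : X.A p) (y : X.A q) :
    cast (congrArg X.A (Nat.add_comm q p)) (X.shuffleBracket y x) =
      ((-1 : ℚ) ^ (p * q + 1)) • X.shuffleBracket x y := by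
  let e : Finset (Fin (p + q)) ≃ Finset (Fin (q + p)) :=
    (compl_involutive.toPerm _).trans (finCongr (Nat.add_comm p q)).finsetCongr
  have he (σ) : σᶜ.map (finCongr (Nat.add_comm p q)).toEmbedding = e σ := rfl
  rw [SimplicialLieQ.shuffleBracket, SimplicialLieQ.shuffleBracket, X.cast_sum (Nat.add_comm q p),
    Finset.smul_sum, ← e.sum_comp]
  refine Finset.sum_congr rfl fun σ _ => ?_
  have hcard : (e σ).card = q ↔ σ.card = p := by
    rw [← he, Finset.card_map, Finset.card_compl, Fintype.card_fin]
    have := σ.card_le_univ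
    rw [Fintype.card_fin] at this
    omega
  by_cases h : σ.card = p
  · rw [dif_pos h, dif_pos (hcard.2 h), X.cast_smul (Nat.add_comm q p),
      X.cast_shuffleTerm x y σ h (e σ) (hcard.2 h) (he σ), ← he, shuffleSign_map_finCongr,
      neg_one_zpow_shuffleSign_compl σ h, smul_smul, pow_succ, smul_neg, ← neg_smul]
    congr 1
    ring
  · rw [dif_neg h, dif_neg (mt hcard.1 h), X.cast_zero (Nat.add_comm q p), smul_zero]
end

section
/- Let A be a simplicial Lie algebra over ℚ and let x ∈ A_p, y ∈ A_q, z ∈ A_r (p, q, r ≥ 0). Then the shuffle bracket satisfies the graded Jacobi identity (−1)^{pr} ⟦⟦x,y⟧,z⟧ + (−1)^{pq} ⟦⟦y,z⟧,x⟧ + (−1)^{qr} ⟦⟦z,x⟧,y⟧ = 0 in A_{p+q+r}. -/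
section ShuffleProduct

variable {R L : Type*} [CommRing R] [LieRing L] [LieAlgebra R L] (S : ℕ → L →ₗ⁅R⁆ L)

/-- The shuffle bracket of bidegree `(p, q)` on the positions `k, k + 1, …, k + p + q - 1`, defined
by recursion on the block of the shuffle that contains the first position `k`. -/
def recShuffle : ℕ → ℕ → ℕ → L → L → L
  | _, 0, 0, x, y => ⁅x, y⁆
  | k, 0, q + 1, x, y => recShuffle (k + 1) 0 q (S k x) y
  | k, p + 1, 0, x, y => recShuffle (k + 1) p 0 x (S k y)
  | k, p + 1, q + 1, x, y =>
    recShuffle (k + 1) p (q + 1) x (S k y) +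
      (-1 : R) ^ (p + 1) • recShuffle (k + 1) (p + 1) q (S k x) y
termination_by _ p q => p + q

lemma recShuffle_step (k p q : ℕ) (x y : L) (h : p + q ≠ 0) :
    recShuffle S k p q x y =
      (if p = 0 then 0 else recShuffle S (k + 1) (p - 1) q x (S k y)) +
      (if q = 0 then 0 else (-1 : R) ^ p • recShuffle S (k + 1) p (q - 1) (S k x) y) := by
  rcases p with _ | p <;> rcases q with _ | q
  · simp at h
  all_goals rw [recShuffle]; simp

lemma recShuffle_add_left (k p q : ℕ) (x x' y : L) :
    recShuffle S k p q (x + x') y = recShuffle S k p q x y + recShuffle S k p q x' y := by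
  fun_induction recShuffle S k p q x y generalizing x' with
  | case1 k x y => simp [recShuffle]
  | case2 k q x y ih => simp [recShuffle, ih]
  | case3 k p x y ih => simp [recShuffle, ih]
  | case4 k p q x y ih₁ ih₂ =>
    simp only [recShuffle, map_add, ih₁, ih₂]
    module

lemma recShuffle_smul_left (c : R) (k p q : ℕ) (x y : L) :
    recShuffle S k p q (c • x) y = c • recShuffle S k p q x y := by
  fun_induction recShuffle S k p q x y with
  | case1 k x y => simp [recShuffle]
  | case2 k q x y ih => simp [recShuffle, ih]
  | case3 k p x y ih => simp [recShuffle, ih]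
  | case4 k p q x y ih₁ ih₂ =>
    simp only [recShuffle, map_smul, ih₁, ih₂]
    module

variable {S}

lemma map_recShuffle (hS : ∀ i j, i ≤ j → ∀ x, S i (S j x) = S (j + 1) (S i x))
    (i k p q : ℕ) (hi : i ≤ k) (x y : L) :
    S i (recShuffle S k p q x y) = recShuffle S (k + 1) p q (S i x) (S i y) := by
  fun_induction recShuffle S k p q x y with
  | case1 k x y => simp [recShuffle]
  | case2 k q x y ih => simp [recShuffle, ih (by omega), hS i k hi]
  | case3 k p x y ih => simp [recShuffle, ih (by omega), hS i k hi]
  | case4 k p q x y ih₁ ih₂ =>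
    simp [recShuffle, ih₁ (by omega), ih₂ (by omega), hS i k hi]

lemma recShuffle_recShuffle_step (hS : ∀ i j, i ≤ j → ∀ x, S i (S j x) = S (j + 1) (S i x))
    (k p q r : ℕ) (x y z : L) (h : p + q + r ≠ 0) :
    recShuffle S k (p + q) r (recShuffle S k p q x y) z =
      (if p = 0 then 0 else
        recShuffle S (k + 1) (p - 1 + q) r
          (recShuffle S (k + 1) (p - 1) q x (S k y)) (S k z)) +
      (if q = 0 then 0 else (-1 : R) ^ p •
        recShuffle S (k + 1) (p + (q - 1)) r
          (recShuffle S (k + 1) p (q - 1) (S k x) y) (S k z)) +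
      (if r = 0 then 0 else (-1 : R) ^ (p + q) •
        recShuffle S (k + 1) (p + q) (r - 1)
          (recShuffle S (k + 1) p q (S k x) (S k y)) z) := by
  rw [recShuffle_step S k (p + q) r _ _ h, map_recShuffle hS k k p q le_rfl]
  congr 1
  by_cases hpq : p + q = 0
  · obtain ⟨rfl, rfl⟩ : p = 0 ∧ q = 0 := by omega
    simp
  · rw [if_neg hpq, recShuffle_step S k p q x y hpq]
    rcases p with _ | p <;> rcases q with _ | q
    · simp at hpq
    · simp
    · simp
    · have h₁ : p + 1 + (q + 1) - 1 = p + 1 + q := by omega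
      have h₂ : p + (q + 1) = p + 1 + q := by omega
      simp [recShuffle_add_left, recShuffle_smul_left, h₁, h₂]

theorem recShuffle_jacobi (hS : ∀ i j, i ≤ j → ∀ x, S i (S j x) = S (j + 1) (S i x))
    (k p q r : ℕ) (x y z : L) :
    (-1 : R) ^ (p * r) • recShuffle S k (p + q) r (recShuffle S k p q x y) z +
      (-1 : R) ^ (p * q) • recShuffle S k (q + r) p (recShuffle S k q r y z) x +
      (-1 : R) ^ (q * r) • recShuffle S k (r + p) q (recShuffle S k r p z x) y = 0 := by
  induction hn : p + q + r generalizing k p q r x y z with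
  | zero =>
    obtain ⟨rfl, rfl, rfl⟩ : p = 0 ∧ q = 0 ∧ r = 0 := by omega
    simp only [recShuffle, mul_zero, pow_zero, one_smul, add_zero]
    rw [← lie_skew ⁅y, z⁆ x, ← lie_skew ⁅z, x⁆ y, ← lie_skew ⁅x, y⁆ z]
    linear_combination (norm := module) (-1 : R) • lie_jacobi x y z
  | succ n ih =>
    rw [recShuffle_recShuffle_step hS k p q r x y z (by omega),
      recShuffle_recShuffle_step hS k q r p y z x (by omega),
      recShuffle_recShuffle_step hS k r p q z x y (by omega)]
    have sq : ∀ m : ℕ, (-1 : R) ^ m * (-1) ^ m = 1 := fun m => by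
      rw [← mul_pow]; simp
    have hp (h : p ≠ 0) := ih (k + 1) (p - 1) q r x (S k y) (S k z) (by omega)
    have hq (h : q ≠ 0) := ih (k + 1) p (q - 1) r (S k x) y (S k z) (by omega)
    have hr (h : r ≠ 0) := ih (k + 1) p q (r - 1) (S k x) (S k y) z (by omega)
    generalize recShuffle S (k + 1) (p - 1 + q) r _ _ = a₁ at *
    generalize recShuffle S (k + 1) (q + r) (p - 1) _ _ = a₂ at *
    generalize recShuffle S (k + 1) (r + (p - 1)) q _ _ = a₃ at *
    generalize recShuffle S (k + 1) (p + (q - 1)) r _ _ = b₁ at *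
    generalize recShuffle S (k + 1) (q - 1 + r) p _ _ = b₂ at *
    generalize recShuffle S (k + 1) (r + p) (q - 1) _ _ = b₃ at *
    generalize recShuffle S (k + 1) (p + q) (r - 1) _ _ = c₁ at *
    generalize recShuffle S (k + 1) (q + (r - 1)) p _ _ = c₂ at *
    generalize recShuffle S (k + 1) (r - 1 + p) q _ _ = c₃ at *
    have hp' : (-1 : R) ^ (p * r) • (if p = 0 then 0 else a₁) +
        (-1 : R) ^ (p * q) • (if p = 0 then 0 else (-1 : R) ^ (q + r) • a₂) +
        (-1 : R) ^ (q * r) • (if p = 0 then 0 else (-1 : R) ^ r • a₃) = 0 := by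
      rcases p with _ | p
      · simp
      · simp only [Nat.add_eq_zero_iff, one_ne_zero, and_false, if_false, ne_eq, not_false_eq_true,
          Nat.add_sub_cancel, forall_const] at hp ⊢
        linear_combination (norm := module) (-1 : R) ^ r • hp +
          sq q • ((-1 : R) ^ (p * q) * (-1 : R) ^ r) • a₂
    have hq' : (-1 : R) ^ (p * r) • (if q = 0 then 0 else (-1 : R) ^ p • b₁) +
        (-1 : R) ^ (p * q) • (if q = 0 then 0 else b₂) +
        (-1 : R) ^ (q * r) • (if q = 0 then 0 else (-1 : R) ^ (r + p) • b₃) = 0 := by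
      rcases q with _ | q
      · simp
      · simp only [Nat.add_eq_zero_iff, one_ne_zero, and_false, if_false, ne_eq, not_false_eq_true,
          Nat.add_sub_cancel, forall_const] at hq ⊢
        linear_combination (norm := module) (-1 : R) ^ p • hq +
          sq r • ((-1 : R) ^ (q * r) * (-1 : R) ^ p) • b₃
    have hr' : (-1 : R) ^ (p * r) • (if r = 0 then 0 else (-1 : R) ^ (p + q) • c₁) +
        (-1 : R) ^ (p * q) • (if r = 0 then 0 else (-1 : R) ^ q • c₂) +
        (-1 : R) ^ (q * r) • (if r = 0 then 0 else c₃) = 0 := by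
      rcases r with _ | r
      · simp
      · simp only [Nat.add_eq_zero_iff, one_ne_zero, and_false, if_false, ne_eq, not_false_eq_true,
          Nat.add_sub_cancel, forall_const] at hr ⊢
        linear_combination (norm := module) (-1 : R) ^ q • hr +
          sq p • ((-1 : R) ^ (p * r) * (-1 : R) ^ q) • c₁
    simp only [smul_add]
    linear_combination (norm := module) hp' + hq' + hr'

/-- The composite of the operators `S j`, `j ∈ T`, with the smallest index applied first. -/
def sortedComp (S : ℕ → L →ₗ⁅R⁆ L) (T : Finset ℕ) (x : L) : L :=
  (T.sort (· ≤ ·)).foldl (fun v j => S j v) x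

lemma sortedComp_insert (S : ℕ → L →ₗ⁅R⁆ L) (k : ℕ) (T : Finset ℕ) (hT : ∀ b ∈ T, k < b)
    (x : L) : sortedComp S (insert k T) x = sortedComp S T (S k x) := by
  rw [sortedComp, Finset.sort_insert _ (fun b hb => (hT b hb).le) fun h => (hT k h).false]
  rfl

/-- The summand of the shuffle bracket on the positions in `I` with least element `k`, indexed by
`σ ⊆ I`; it vanishes unless `σ` has `p` elements. -/
def shuffleSummand (S : ℕ → L →ₗ⁅R⁆ L) (k : ℕ) (I : Finset ℕ) (p : ℕ) (x y : L)
    (σ : Finset ℕ) : L :=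
  if σ.card = p then
    (-1 : R) ^ (∑ a ∈ σ, (a - k) + ∑ i ∈ Finset.range σ.card, i) •
      ⁅sortedComp S (I \ σ) x, sortedComp S σ y⁆
  else 0

lemma shuffleSummand_of_notMem (S : ℕ → L →ₗ⁅R⁆ L) (k : ℕ) (I : Finset ℕ) (hI : ∀ b ∈ I, k < b)
    (p : ℕ) (x y : L) (σ : Finset ℕ) (hσ : σ ⊆ I) :
    shuffleSummand S k (insert k I) p x y σ =
      (-1 : R) ^ p • shuffleSummand S (k + 1) I p (S k x) y σ := by
  have hk : k ∉ σ := fun h => (hI k (hσ h)).false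
  unfold shuffleSummand
  split_ifs with h
  · rw [Finset.insert_sdiff_of_notMem _ hk, sortedComp_insert _ _ _
      fun b hb => hI b (Finset.sdiff_subset hb), smul_smul, ← pow_add]
    congr 2
    have : ∑ a ∈ σ, (a - k) = ∑ a ∈ σ, (a - (k + 1)) + p := by
      rw [← h, Finset.card_eq_sum_ones, ← Finset.sum_add_distrib]
      refine Finset.sum_congr rfl fun a ha => ?_
      have := hI a (hσ ha)
      omega
    omega
  · simp

lemma shuffleSummand_insert (S : ℕ → L →ₗ⁅R⁆ L) (k : ℕ) (I : Finset ℕ) (hI : ∀ b ∈ I, k < b)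
    (p : ℕ) (x y : L) (σ : Finset ℕ) (hσ : σ ⊆ I) :
    shuffleSummand S k (insert k I) (p + 1) x y (insert k σ) =
      shuffleSummand S (k + 1) I p x (S k y) σ := by
  have hk : k ∉ σ := fun h => (hI k (hσ h)).false
  have hkI : k ∉ I := fun h => (hI k h).false
  unfold shuffleSummand
  simp only [Finset.card_insert_of_notMem hk, Nat.add_right_cancel_iff]
  split_ifs with h
  · have h₁ : insert k I \ insert k σ = I \ σ := by
      rw [Finset.insert_sdiff_insert, Finset.sdiff_insert_of_notMem hkI]
    rw [h₁, sortedComp_insert _ _ _ fun b hb => hI b (hσ hb)]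
    congr 1
    have h₂ : ∑ a ∈ insert k σ, (a - k) = ∑ a ∈ σ, (a - (k + 1)) + σ.card := by
      rw [Finset.sum_insert hk, Finset.card_eq_sum_ones, ← Finset.sum_add_distrib, Nat.sub_self,
        zero_add]
      refine Finset.sum_congr rfl fun a ha => ?_
      have := hI a (hσ ha)
      omega
    rw [h₂, Finset.sum_range_succ, show ∀ a b c : ℕ, a + c + (b + c) = a + b + 2 * c by
      intros; omega, pow_add _ _ (2 * σ.card), pow_mul]
    simp
  · rfl

lemma sum_shuffleSummand (S : ℕ → L →ₗ⁅R⁆ L) (k p q : ℕ) (x y : L) :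
    ∑ σ ∈ (Finset.Ico k (k + (p + q))).powerset,
      shuffleSummand S k (Finset.Ico k (k + (p + q))) p x y σ = recShuffle S k p q x y := by
  induction hn : p + q generalizing k p q x y with
  | zero =>
    obtain ⟨rfl, rfl⟩ : p = 0 ∧ q = 0 := by omega
    simp [shuffleSummand, sortedComp, recShuffle]
  | succ n ih =>
    have hins : Finset.Ico k (k + (n + 1)) = insert k (Finset.Ico (k + 1) (k + 1 + n)) := by
      ext a
      simp only [Finset.mem_Ico, Finset.mem_insert]
      omega
    have hI : ∀ b ∈ Finset.Ico (k + 1) (k + 1 + n), k < b := fun b hb => by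
      simp only [Finset.mem_Ico] at hb
      omega
    rw [hins, Finset.sum_powerset_insert (by simp), recShuffle_step S k p q x y (by omega),
      add_comm]
    congr 1
    · rcases p with _ | p
      · refine Finset.sum_eq_zero fun σ hσ => if_neg ?_
        simp
      · rw [if_neg (by omega), Nat.add_sub_cancel, ← ih (k + 1) p q x (S k y) (by omega)]
        exact Finset.sum_congr rfl fun σ hσ =>
          shuffleSummand_insert S k _ hI p x y σ (Finset.mem_powerset.1 hσ)
    · rcases q with _ | q
      · refine Finset.sum_eq_zero fun σ hσ => if_neg fun h => ?_
        have := Finset.card_le_card (Finset.mem_powerset.1 hσ)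
        simp only [Nat.card_Ico] at this
        omega
      · rw [if_neg (by omega), Nat.add_sub_cancel, ← ih (k + 1) p q (S k x) y (by omega),
          Finset.smul_sum]
        exact Finset.sum_congr rfl fun σ hσ =>
          shuffleSummand_of_notMem S k _ hI p x y σ (Finset.mem_powerset.1 hσ)

end ShuffleProduct

lemma ofFn_orderEmbOfFin_val {m c : ℕ} (σ : Finset (Fin m)) (h : σ.card = c) :
    List.ofFn (fun i => (σ.orderEmbOfFin h i : ℕ)) =
      (σ.map Fin.valEmbedding).sort (· ≤ ·) := by
  have h' : (σ.map Fin.valEmbedding).card = c := by rw [Finset.card_map, h]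
  have := Finset.orderEmbOfFin_unique h' (f := fun i => (σ.orderEmbOfFin h i : ℕ))
    (fun i => Finset.mem_map_of_mem Fin.valEmbedding (σ.orderEmbOfFin_mem h i))
    (fun i j hij => (σ.orderEmbOfFin h).strictMono hij)
  rw [this]
  refine List.ext_getElem (by simp [h]) fun i h₁ h₂ => ?_
  simp [Finset.orderEmbOfFin_apply]

lemma neg_one_zpow_shuffleSign {m : ℕ} (σ : Finset (Fin m)) :
    (-1 : ℚ) ^ shuffleSign σ =
      (-1 : ℚ) ^ (∑ a ∈ σ, (a : ℕ) + ∑ i ∈ Finset.range σ.card, i) := by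
  have h : shuffleSign σ = ((∑ a ∈ σ, (a : ℕ) + ∑ i ∈ Finset.range σ.card, i : ℕ) : ℤ) +
      2 * -(∑ i ∈ Finset.range σ.card, (i : ℤ)) := by
    simp only [shuffleSign, Finset.sum_add_distrib]
    push_cast
    simp only [Finset.sum_const, Finset.card_range, nsmul_eq_mul, mul_one]
    ring
  rw [h, zpow_add₀ (by norm_num), zpow_mul, zpow_natCast]
  norm_num

namespace SimplicialLieQ

open DirectSum

variable (X : SimplicialLieQ)

/-- The degeneracies `s_j : A_n → A_{n+1}`, assembled into an endomorphism of the Lie algebra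
`⨁ n, A_n` which vanishes on `A_n` for `n < j`. -/
noncomputable def totalDegeneracy (j : ℕ) : (⨁ n, X.A n) →ₗ⁅ℚ⁆ (⨁ n, X.A n) :=
  DirectSum.toLieAlgebra (⨁ n, X.A n)
    (fun n => if j ≤ n then (DirectSum.lieAlgebraOf ℚ ℕ X.A (n + 1)).comp (X.s n j) else 0)
    (fun m n hmn x y => by
      have hne : m ≠ n := hmn
      by_cases hm : j ≤ m <;> by_cases hn : j ≤ n <;> simp [hm, hn, hne])

lemma totalDegeneracy_of (j n : ℕ) (x : X.A n) :
    X.totalDegeneracy j (of X.A n x) = if j ≤ n then of X.A (n + 1) (X.s n j x) else 0 := by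
  have : X.totalDegeneracy j (of X.A n x) =
      (if j ≤ n then (DirectSum.lieAlgebraOf ℚ ℕ X.A (n + 1)).comp (X.s n j) else 0) x :=
    DirectSum.toModule_lof ℚ n x
  rw [this]
  split_ifs <;> rfl

lemma totalDegeneracy_comm (i j : ℕ) (hij : i ≤ j) (x : ⨁ n, X.A n) :
    X.totalDegeneracy i (X.totalDegeneracy j x) =
      X.totalDegeneracy (j + 1) (X.totalDegeneracy i x) := by
  induction x using DirectSum.induction_on with
  | zero => simp
  | add x y hx hy => simp only [map_add, hx, hy]
  | of n x =>
    simp only [totalDegeneracy_of]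
    by_cases hj : j ≤ n
    · simp [hj, hij.trans hj, totalDegeneracy_of, (hij.trans hj).trans (Nat.le_succ n),
        X.ss n i j hij hj]
    · by_cases hi : i ≤ n <;> simp [hi, hj, totalDegeneracy_of]

lemma of_cast {m n : ℕ} (h : m = n) (x : X.A m) :
    of X.A n (cast (congrArg X.A h) x) = of X.A m x := by
  subst h
  rfl

lemma of_iterS (n k : ℕ) (f : Fin k → ℕ) (hf : StrictMono f) (hlt : ∀ i, f i < n + k)
    (x : X.A n) :
    of X.A (n + k) (X.iterS n k f x) =
      (List.ofFn f).foldl (fun v j => X.totalDegeneracy j v) (of X.A n x) := by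
  induction k with
  | zero => simp [iterS]
  | succ k ih =>
    have hlast := hlt (Fin.last k)
    rw [List.ofFn_succ', List.concat_eq_append, List.foldl_append,
      ← ih (fun i => f i.castSucc) (hf.comp Fin.strictMono_castSucc) fun i => by
        have := hf (Fin.castSucc_lt_last i)
        omega, List.foldl_cons, List.foldl_nil, totalDegeneracy_of, if_pos (by omega)]
    rfl

lemma of_iterS_orderEmbOfFin {m n k : ℕ} (hm : m = n + k) (T : Finset (Fin m)) (h : T.card = k)
    (x : X.A n) :
    of X.A (n + k) (X.iterS n k (fun i => (T.orderEmbOfFin h i : ℕ)) x) =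
      sortedComp X.totalDegeneracy (T.map Fin.valEmbedding) (of X.A n x) := by
  rw [of_iterS, ofFn_orderEmbOfFin_val, sortedComp]
  · exact fun i j hij => (T.orderEmbOfFin h).strictMono hij
  · exact fun i => hm ▸ (T.orderEmbOfFin h i).isLt

lemma of_shuffleBracket {p q : ℕ} (x : X.A p) (y : X.A q) :
    of X.A (p + q) (X.shuffleBracket x y) =
      recShuffle X.totalDegeneracy 0 p q (of X.A p x) (of X.A q y) := by
  rw [← sum_shuffleSummand, shuffleBracket, map_sum]
  refine Finset.sum_nbij (fun σ => σ.map Fin.valEmbedding) ?_ ?_ ?_ ?_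
  · intro σ _
    simp only [Finset.mem_powerset, Finset.subset_iff, Finset.mem_map, Finset.mem_Ico]
    rintro _ ⟨a, -, rfl⟩
    simp
  · exact fun σ _ τ _ h => Finset.map_injective _ h
  · intro T hT
    simp only [Finset.coe_powerset, Set.mem_preimage, Set.mem_powerset_iff, Finset.coe_subset,
      zero_add] at hT
    refine ⟨Finset.univ.filter fun a => (a : ℕ) ∈ T, by simp, ?_⟩
    ext a
    simp only [Finset.mem_map, Finset.mem_filter, Finset.mem_univ, true_and,
      Fin.valEmbedding_apply]
    refine ⟨?_, fun ha => ⟨⟨a, (Finset.mem_Ico.1 (hT ha)).2⟩, ha, rfl⟩⟩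
    rintro ⟨b, hb, rfl⟩
    exact hb
  · intro σ _
    have hc : Finset.Ico 0 (0 + (p + q)) \ σ.map Fin.valEmbedding = σᶜ.map Fin.valEmbedding := by
      ext a
      simp only [Finset.mem_sdiff, Finset.mem_Ico, Finset.mem_map, Finset.mem_compl,
        Fin.valEmbedding_apply, zero_le, true_and, zero_add]
      refine ⟨fun h => ⟨⟨a, h.1⟩, fun ha => h.2 ⟨_, ha, rfl⟩, rfl⟩, ?_⟩
      rintro ⟨b, hb, rfl⟩
      exact ⟨b.isLt, fun ⟨c, hc, hcb⟩ => hb (Fin.ext hcb ▸ hc)⟩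
    rw [shuffleSummand, hc, Finset.card_map]
    split_ifs with h
    · rw [neg_one_zpow_shuffleSign, Finset.sum_map, shuffleTerm]
      have hsmul (c : ℚ) (v : X.A (p + q)) : of X.A (p + q) (c • v) = c • of X.A (p + q) v :=
        (lof ℚ ℕ X.A (p + q)).map_smul c v
      rw [hsmul, ← lie_of_same, of_iterS_orderEmbOfFin X rfl, of_cast X (Nat.add_comm q p),
        of_iterS_orderEmbOfFin X (Nat.add_comm p q)]
      rfl
    · exact map_zero _

end SimplicialLieQ

/-- For a simplicial Lie algebra `A` over `ℚ` and `x ∈ A_p`,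
`y ∈ A_q`, `z ∈ A_r` (`p, q, r ≥ 0`), the shuffle bracket satisfies the graded
Jacobi identity
`(-1)^{pr} ⟦⟦x,y⟧,z⟧ + (-1)^{pq} ⟦⟦y,z⟧,x⟧ + (-1)^{qr} ⟦⟦z,x⟧,y⟧ = 0`
in `A_{p+q+r}`. -/
theorem shuffleBracket_jacobi (X : SimplicialLieQ) (p q r : ℕ)
    (x : X.A p) (y : X.A q) (z : X.A r) :
    ((-1 : ℚ) ^ (p * r)) • X.shuffleBracket (X.shuffleBracket x y) z +
      ((-1 : ℚ) ^ (p * q)) •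
        cast (congrArg X.A (by omega : q + r + p = p + q + r))
          (X.shuffleBracket (X.shuffleBracket y z) x) +
      ((-1 : ℚ) ^ (q * r)) •
        cast (congrArg X.A (by omega : r + p + q = p + q + r))
          (X.shuffleBracket (X.shuffleBracket z x) y) = 0 := by
  apply DirectSum.of_injective (p + q + r)
  have hsmul (c : ℚ) (v : X.A (p + q + r)) : DirectSum.of X.A (p + q + r) (c • v) =
      c • DirectSum.of X.A (p + q + r) v :=
    (DirectSum.lof ℚ ℕ X.A (p + q + r)).map_smul c v
  simp only [map_add, map_zero, hsmul, X.of_cast (by omega : q + r + p = p + q + r),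
    X.of_cast (by omega : r + p + q = p + q + r), X.of_shuffleBracket]
  exact recShuffle_jacobi X.totalDegeneracy_comm 0 p q r _ _ _
end

section
/- Let A be a simplicial Lie algebra over ℚ, let p, q ≥ 1, let x ∈ A_p satisfy d_i x = 0 for all 1 ≤ i ≤ p, and let y ∈ A_q satisfy d_j y = 0 for all 1 ≤ j ≤ q (i.e., x and y are Moore chains). Then the shuffle bracket satisfies the Leibniz rule with respect to the Moore differential: d_0(⟦x,y⟧) = ⟦d_0 x, y⟧ + (−1)^p ⟦x, d_0 y⟧ in A_{p+q−1}. -/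
theorem Fin.sum_univ_finset_succ {M : Type*} [AddCommMonoid M] {m : ℕ}
    (f : Finset (Fin (m + 1)) → M) :
    ∑ σ, f σ = ∑ σ : Finset (Fin m), f (insert 0 (σ.map (Fin.succEmb m))) +
      ∑ σ : Finset (Fin m), f (σ.map (Fin.succEmb m)) := by
  have h0 : (0 : Fin (m + 1)) ∉ Finset.univ.map (Fin.succEmb m) := by
    simp [Fin.succ_ne_zero]
  have hu : (Finset.univ : Finset (Fin (m + 1))) =
      insert 0 (Finset.univ.map (Fin.succEmb m)) := by
    ext i
    cases i using Fin.cases <;> simp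
  have hmap (g : Finset (Fin (m + 1)) → M) :
      ∑ σ ∈ (Finset.univ.map (Fin.succEmb m)).powerset, g σ =
        ∑ σ : Finset (Fin m), g (σ.map (Fin.succEmb m)) := by
    refine (Finset.sum_bij (fun σ _ => σ.map (Fin.succEmb m)) ?_ ?_ ?_ ?_).symm
    · intro σ _
      simp
    · intro σ _ τ _ h
      exact Finset.map_injective _ h
    · intro τ hτ
      obtain ⟨σ, _, rfl⟩ := Finset.subset_map_iff.1 (Finset.mem_powerset.1 hτ)
      exact ⟨σ, Finset.mem_univ _, rfl⟩
    · intros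
      rfl
  rw [← Finset.powerset_univ, hu, Finset.sum_powerset_insert h0, hmap, hmap, add_comm]

namespace Finset

variable {m k : ℕ}

theorem zero_notMem_map_succEmb (σ : Finset (Fin m)) : 0 ∉ σ.map (Fin.succEmb m) := by
  simp [Fin.succ_ne_zero]

theorem card_insert_zero_map_succEmb (σ : Finset (Fin m)) :
    (insert 0 (σ.map (Fin.succEmb m))).card = σ.card + 1 := by
  rw [card_insert_of_notMem σ.zero_notMem_map_succEmb, card_map]

theorem compl_map_succEmb (σ : Finset (Fin m)) :
    (σ.map (Fin.succEmb m))ᶜ = insert 0 (σᶜ.map (Fin.succEmb m)) := by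
  ext i
  cases i using Fin.cases <;> simp [Fin.succ_ne_zero]

theorem compl_insert_zero_map_succEmb (σ : Finset (Fin m)) :
    (insert 0 (σ.map (Fin.succEmb m)))ᶜ = σᶜ.map (Fin.succEmb m) := by
  ext i
  cases i using Fin.cases <;> simp [Fin.succ_ne_zero]

theorem orderEmbOfFin_map_succEmb (σ : Finset (Fin m)) (h : σ.card = k)
    (h' : (σ.map (Fin.succEmb m)).card = k) (i : Fin k) :
    (σ.map (Fin.succEmb m)).orderEmbOfFin h' i = (σ.orderEmbOfFin h i).succ := by
  refine (congrFun (orderEmbOfFin_unique (f := fun i => (σ.orderEmbOfFin h i).succ) h'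
    (fun i => ?_) (fun i j hij => ?_)) i).symm
  · exact mem_map_of_mem (Fin.succEmb m) (orderEmbOfFin_mem σ h i)
  · simpa using hij

theorem orderEmbOfFin_insert_zero_map_succEmb (σ : Finset (Fin m)) (h : σ.card = k)
    (h' : (insert 0 (σ.map (Fin.succEmb m))).card = k + 1) (i : Fin (k + 1)) :
    (insert 0 (σ.map (Fin.succEmb m))).orderEmbOfFin h' i =
      Fin.cases 0 (fun i => (σ.orderEmbOfFin h i).succ) i := by
  refine (congrFun (orderEmbOfFin_unique
    (f := fun i => Fin.cases 0 (fun i => (σ.orderEmbOfFin h i).succ) i) h'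
    (fun i => ?_) (fun i j hij => ?_)) i).symm
  · cases i using Fin.cases with
    | zero => simp
    | succ i =>
      exact mem_insert_of_mem
        (mem_map_of_mem (Fin.succEmb m) (orderEmbOfFin_mem σ h i))
  · cases i using Fin.cases with
    | zero =>
      cases j using Fin.cases with
      | zero => exact absurd hij (lt_irrefl _)
      | succ j => exact Fin.succ_pos _
    | succ i =>
      cases j using Fin.cases with
      | zero => exact absurd hij (Fin.not_lt_zero _)
      | succ j => simpa using hij

end Finset

theorem shuffleSign_map_succEmb {m : ℕ} (σ : Finset (Fin m)) :
    shuffleSign (σ.map (Fin.succEmb m)) = σ.card + shuffleSign σ := by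
  simp only [shuffleSign, Finset.card_map, Finset.sum_map, Fin.coe_succEmb, Fin.val_succ]
  push_cast
  simp only [Finset.sum_add_distrib, Finset.sum_const, nsmul_eq_mul, mul_one]
  ring

theorem shuffleSign_insert_zero_map_succEmb {m : ℕ} (σ : Finset (Fin m)) :
    shuffleSign (insert 0 (σ.map (Fin.succEmb m))) = shuffleSign σ := by
  rw [shuffleSign, shuffleSign, Finset.card_insert_zero_map_succEmb,
    Finset.sum_insert σ.zero_notMem_map_succEmb, Finset.sum_range_succ]
  simp only [Finset.sum_map, Fin.coe_succEmb, Fin.val_succ]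
  push_cast
  simp only [Finset.sum_add_distrib, Finset.sum_const, nsmul_eq_mul, mul_one, Fin.val_zero]
  push_cast
  ring

namespace SimplicialLieQ

variable (X : SimplicialLieQ)

theorem d_cast {m n : ℕ} (h : m = n) (i : ℕ) (x : X.A m) :
    X.d n i (cast (congrArg X.A h) x) =
      cast (congrArg (fun n => X.A (n - 1)) h) (X.d m i x) := by
  subst h
  rfl

theorem s_cast {m n : ℕ} (h : m = n) (j : ℕ) (x : X.A m) :
    X.s n j (cast (congrArg X.A h) x) =
      cast (congrArg (fun n => X.A (n + 1)) h) (X.s m j x) := by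
  subst h
  rfl

theorem d_zero_s {n j : ℕ} (hn : 1 ≤ n) (hj : 1 ≤ j) (hjn : j ≤ n) (x : X.A n) :
    X.d (n + 1) 0 (X.s n j x) =
      cast (congrArg X.A (Nat.sub_add_cancel hn)) (X.s (n - 1) (j - 1) (X.d n 0 x)) := by
  obtain ⟨n, rfl⟩ := Nat.exists_eq_add_of_le' hn
  exact X.ds_lt n 0 j hj hjn x

theorem d_zero_iterS {n k : ℕ} (f : Fin k → ℕ) (hf : StrictMono f) (hf1 : ∀ i, 1 ≤ f i)
    (hfk : ∀ i, f i < n + 1 + k) (x : X.A (n + 1)) :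
    X.d (n + 1 + k) 0 (X.iterS (n + 1) k f x) =
      cast (congrArg X.A (by omega : n + k = n + 1 + k - 1))
        (X.iterS n k (fun i => f i - 1) (X.d (n + 1) 0 x)) := by
  induction k with
  | zero => rfl
  | succ k ih =>
    have hlast := hfk (Fin.last k)
    have ih := ih (fun i => f i.castSucc) (fun i j hij => hf (by simpa using hij))
      (fun i => hf1 _) (fun i => by
        have := hf (Fin.castSucc_lt_last i)
        omega)
    refine (X.d_zero_s (n := n + 1 + k) (by omega) (hf1 _) (by omega) _).trans ?_
    rw [ih, X.s_cast (by omega : n + k = n + 1 + k - 1), cast_cast]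
    rfl

theorem d_zero_iterS_succ {n k : ℕ} (f : Fin (k + 1) → ℕ) (hf : StrictMono f) (hf0 : f 0 = 0)
    (hfk : ∀ i, f i < n + (k + 1)) (x : X.A n) :
    X.d (n + (k + 1)) 0 (X.iterS n (k + 1) f x) =
      X.iterS n k (fun i => f i.succ - 1) x := by
  induction k with
  | zero =>
    change X.d (n + 1) 0 (X.s n (f 0) x) = x
    rw [hf0]
    exact X.ds_eq n 0 (Nat.zero_le _) x
  | succ k ih =>
    have hlast := hfk (Fin.last (k + 1))
    have hpos : 0 < f (Fin.last (k + 1)) := hf0 ▸ hf (Fin.last_pos)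
    have ih := ih (fun i => f i.castSucc) (fun i j hij => hf (by simpa using hij))
      hf0 (fun i => by
        have := hf (Fin.castSucc_lt_last i)
        omega)
    refine (X.ds_lt (n + k) 0 (f (Fin.last (k + 1))) hpos (by omega) _).trans ?_
    exact congrArg (X.s (n + k) (f (Fin.last (k + 1)) - 1)) ih

/-- The iterated degeneracy `s_{τ_k} ⋯ s_{τ_1} x` along `τ = {τ_1 < … < τ_k}`. -/
noncomputable def degeneracyAlong {n k m : ℕ} (hm : n + k = m) (τ : Finset (Fin m))
    (hτ : τ.card = k) (x : X.A n) : X.A m :=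
  cast (congrArg X.A hm) (X.iterS n k (fun i => (τ.orderEmbOfFin hτ i : ℕ)) x)

theorem d_zero_degeneracyAlong_map_succEmb {n k m : ℕ} (hm : n + k = m)
    (hm' : n + 1 + k = m + 1) (τ : Finset (Fin m)) (hτ : τ.card = k)
    (hτ' : (τ.map (Fin.succEmb m)).card = k) (x : X.A (n + 1)) :
    X.d (m + 1) 0 (X.degeneracyAlong hm' (τ.map (Fin.succEmb m)) hτ' x) =
      X.degeneracyAlong hm τ hτ (X.d (n + 1) 0 x) := by
  rw [degeneracyAlong, degeneracyAlong, X.d_cast hm', d_zero_iterS, cast_cast]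
  · simp [Finset.orderEmbOfFin_map_succEmb τ hτ]
  · exact fun i j hij => by simpa using hij
  · simp [Finset.orderEmbOfFin_map_succEmb τ hτ]
  · exact fun i => (Fin.isLt _).trans_eq hm'.symm

theorem d_zero_degeneracyAlong_insert_zero {n k m : ℕ} (hm : n + k = m)
    (hm' : n + (k + 1) = m + 1) (τ : Finset (Fin m)) (hτ : τ.card = k)
    (hτ' : (insert 0 (τ.map (Fin.succEmb m))).card = k + 1) (x : X.A n) :
    X.d (m + 1) 0 (X.degeneracyAlong hm' (insert 0 (τ.map (Fin.succEmb m))) hτ' x) =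
      X.degeneracyAlong hm τ hτ x := by
  rw [degeneracyAlong, degeneracyAlong, X.d_cast hm', d_zero_iterS_succ]
  · simp [Finset.orderEmbOfFin_insert_zero_map_succEmb τ hτ]
  · exact fun i j hij => by simpa using hij
  · simp [Finset.orderEmbOfFin_insert_zero_map_succEmb τ hτ]
  · exact fun i => (Fin.isLt _).trans_eq hm'.symm

theorem degeneracyAlong_congr {n k m : ℕ} (hm : n + k = m) {τ τ' : Finset (Fin m)}
    (h : τ = τ') (hτ : τ.card = k) (x : X.A n) :
    X.degeneracyAlong hm τ hτ x = X.degeneracyAlong hm τ' (h ▸ hτ) x := by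
  subst h
  rfl

theorem card_compl_of_add_eq {p q m : ℕ} (hm : p + q = m) {σ : Finset (Fin m)}
    (h : σ.card = p) : σᶜ.card = q := by
  subst hm
  exact card_compl_shuffle σ h

/-- The shuffle bracket with values in `A_m`, where `p + q = m`. -/
noncomputable def shuffleBracketOfEq {p q m : ℕ} (hm : p + q = m) (x : X.A p) (y : X.A q) :
    X.A m :=
  ∑ σ : Finset (Fin m), if h : σ.card = p then
    ((-1 : ℚ) ^ shuffleSign σ) •
      ⁅X.degeneracyAlong hm σᶜ (card_compl_of_add_eq hm h) x,
        X.degeneracyAlong ((Nat.add_comm q p).trans hm) σ h y⁆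
    else 0

theorem cast_shuffleBracket {p q m : ℕ} (hm : p + q = m) (x : X.A p) (y : X.A q) :
    cast (congrArg X.A hm) (X.shuffleBracket x y) = X.shuffleBracketOfEq hm x y := by
  subst hm
  rfl

theorem d_zero_shuffleBracketOfEq {p q m : ℕ} (hm : p + 1 + (q + 1) = m + 1)
    (hpm : p + (q + 1) = m) (hqm : p + 1 + q = m) (x : X.A (p + 1)) (y : X.A (q + 1)) :
    X.d (m + 1) 0 (X.shuffleBracketOfEq hm x y) =
      X.shuffleBracketOfEq hpm (X.d (p + 1) 0 x) y +
        ((-1 : ℚ) ^ (p + 1)) • X.shuffleBracketOfEq hqm x (X.d (q + 1) 0 y) := by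
  rw [shuffleBracketOfEq, Fin.sum_univ_finset_succ, map_add, map_sum, map_sum]
  congr 1
  · refine Finset.sum_congr rfl fun σ _ => ?_
    by_cases h : σ.card = p
    · have h' : (insert 0 (σ.map (Fin.succEmb m))).card = p + 1 := by
        rw [Finset.card_insert_zero_map_succEmb, h]
      rw [dif_pos h, dif_pos h', map_smul, LieHom.map_lie, shuffleSign_insert_zero_map_succEmb,
        X.degeneracyAlong_congr hm σ.compl_insert_zero_map_succEmb]
      erw [X.d_zero_degeneracyAlong_map_succEmb hpm hm σᶜ (card_compl_of_add_eq hpm h),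
        X.d_zero_degeneracyAlong_insert_zero ((Nat.add_comm _ _).trans hpm) _ σ h]
    · rw [dif_neg h, dif_neg, map_zero]
      rwa [Finset.card_insert_zero_map_succEmb, Nat.add_right_cancel_iff]
  · rw [shuffleBracketOfEq, Finset.smul_sum]
    refine Finset.sum_congr rfl fun σ _ => ?_
    by_cases h : σ.card = p + 1
    · have h' : (σ.map (Fin.succEmb m)).card = p + 1 := by
        rw [Finset.card_map, h]
      rw [dif_pos h, dif_pos h', map_smul, LieHom.map_lie, shuffleSign_map_succEmb, h,
        zpow_add₀ (by norm_num), zpow_natCast, mul_smul,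
        X.degeneracyAlong_congr hm σ.compl_map_succEmb]
      erw [X.d_zero_degeneracyAlong_insert_zero hqm hm σᶜ (card_compl_of_add_eq hqm h),
        X.d_zero_degeneracyAlong_map_succEmb ((Nat.add_comm _ _).trans hqm) _ σ h]
    · rw [dif_neg h, dif_neg, map_zero, smul_zero]
      rwa [Finset.card_map]

end SimplicialLieQ

/-- Let `A` be a simplicial Lie algebra over `ℚ`, `p, q ≥ 1`,
let `x ∈ A_p` satisfy `d_i x = 0` for all `1 ≤ i ≤ p`, and let `y ∈ A_q` satisfy
`d_j y = 0` for all `1 ≤ j ≤ q` (i.e. `x, y` are Moore chains).  Then the shuffle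
bracket satisfies the Leibniz rule for the Moore differential `d_0`:
`d_0 ⟦x,y⟧ = ⟦d_0 x, y⟧ + (-1)^p ⟦x, d_0 y⟧` in `A_{p+q-1}`. -/
theorem shuffleBracket_leibniz (X : SimplicialLieQ) (p q : ℕ) (hp : 1 ≤ p) (hq : 1 ≤ q)
    (x : X.A p) (y : X.A q)
    (hx : ∀ i : ℕ, 1 ≤ i → i ≤ p → X.d p i x = 0)
    (hy : ∀ j : ℕ, 1 ≤ j → j ≤ q → X.d q j y = 0) :
    X.d (p + q) 0 (X.shuffleBracket x y) =
      cast (congrArg X.A (by omega : p - 1 + q = p + q - 1))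
        (X.shuffleBracket (X.d p 0 x) y) +
      ((-1 : ℚ) ^ p) •
        cast (congrArg X.A (by omega : p + (q - 1) = p + q - 1))
          (X.shuffleBracket x (X.d q 0 y)) := by
  obtain ⟨p, rfl⟩ := Nat.exists_eq_add_of_le' hp
  obtain ⟨q, rfl⟩ := Nat.exists_eq_add_of_le' hq
  have h := X.d_zero_shuffleBracketOfEq (m := p + 1 + q) rfl (by omega) rfl x y
  rw [← X.cast_shuffleBracket, ← X.cast_shuffleBracket, ← X.cast_shuffleBracket] at h
  exact h
end
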